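/- Let Q be a Boolean CQ and ℛ a set of constant-free datalog rules on predicates 𝒫, and let (𝒬^{Q,ℛ}, ℳ^{Q,ℛ}) be the associated reduction instance. For every CQ Q_w belonging to a piece-rewriting of {Q} with ℛ, the CQ (Q_w)^T is isomorphic to a CQ belonging to some piece-rewriting of 𝒬^{Q,ℛ} with ℳ^{Q,ℛ}. -/

import Mathlib

/-! ## Basic syntax: terms, atoms, substitutions -/

/-- A term over variables `V` and constants `C`. -/
inductive FOTerm (V C : Type) where
  | var (v : V)
  | const (c : C)
deriving DecidableEq

/-- An atom `p(t_1,...,t_n)`. -/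
structure FOAtom (P V C : Type) where
  pred : P
  args : List (FOTerm V C)
deriving DecidableEq

/-- A substitution of variables by terms. -/
abbrev FOSubst (V C : Type) := V → FOTerm V C

variable {P V C : Type}

def FOTerm.applySub (u : FOSubst V C) : FOTerm V C → FOTerm V C
  | FOTerm.var v => u v
  | FOTerm.const c => FOTerm.const c

def FOAtom.applySub (u : FOSubst V C) (a : FOAtom P V C) : FOAtom P V C :=
  ⟨a.pred, a.args.map (FOTerm.applySub u)⟩

def applySubFS [DecidableEq P] [DecidableEq V] [DecidableEq C]
    (u : FOSubst V C) (S : Finset (FOAtom P V C)) : Finset (FOAtom P V C) :=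
  S.image (FOAtom.applySub u)

def FOTerm.varsOf [DecidableEq V] : FOTerm V C → Finset V
  | FOTerm.var v => {v}
  | FOTerm.const _ => ∅

def FOAtom.varsOf [DecidableEq V] (a : FOAtom P V C) : Finset V :=
  a.args.foldr (fun t acc => t.varsOf ∪ acc) ∅

/-- Variables occurring in a finite set of atoms. -/
def varsFS [DecidableEq V] (S : Finset (FOAtom P V C)) : Finset V :=
  S.sup FOAtom.varsOf

/-- Terms occurring in a finite set of atoms. -/
def termsFS [DecidableEq V] [DecidableEq C] (S : Finset (FOAtom P V C)) :
    Finset (FOTerm V C) :=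
  S.sup (fun a => a.args.toFinset)

/-- `h` is a homomorphism from the atom set `S₁` to the atom set `S₂`. -/
def IsHom (h : FOSubst V C) (S₁ S₂ : Finset (FOAtom P V C)) : Prop :=
  ∀ a ∈ S₁, a.applySub h ∈ S₂

/-- `S₂ ⊨ S₁` for atom sets viewed as existentially closed conjunctions:
there is a homomorphism from `S₁` to `S₂`. -/
def EntailsFS (S₂ S₁ : Finset (FOAtom P V C)) : Prop :=
  ∃ h : FOSubst V C, IsHom h S₁ S₂

/-! ## Disjunctive existential rules, triggers, chase step α -/

/-- A disjunctive existential rule `B → H₁ ∨ ... ∨ Hₙ`. -/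
structure DisjRule (P V C : Type) where
  body : Finset (FOAtom P V C)
  heads : List (Finset (FOAtom P V C))

/-- Well-formedness: non-empty body, at least one head disjunct, non-empty disjuncts. -/
def DisjRule.WF (R : DisjRule P V C) : Prop :=
  R.body.Nonempty ∧ R.heads ≠ [] ∧ ∀ H ∈ R.heads, H.Nonempty

/-- All variables of a rule. -/
def DisjRule.vars [DecidableEq V] (R : DisjRule P V C) : Finset V :=
  varsFS R.body ∪ R.heads.foldr (fun H acc => varsFS H ∪ acc) ∅

/-- A trigger `(R, h)` on `F`: `h` is a homomorphism from the body of `R` to `F`. -/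
def IsTrigger (R : DisjRule P V C) (h : FOSubst V C) (F : Finset (FOAtom P V C)) : Prop :=
  IsHom h R.body F

/-- `h'` is a safe extension of `h` for the head disjunct `H` of rule `R` w.r.t. the
fact base `F`: it agrees with `h` outside the existential variables of `H` and renames
the existential variables of `H` injectively to fresh variables. -/
def IsSafeExt [DecidableEq V] (F : Finset (FOAtom P V C)) (R : DisjRule P V C)
    (H : Finset (FOAtom P V C)) (h h' : FOSubst V C) : Prop :=
  (∀ v : V, v ∉ varsFS H \ varsFS R.body → h' v = h v) ∧
  (∀ v ∈ varsFS H \ varsFS R.body, ∃ w : V, h' v = FOTerm.var w ∧ w ∉ varsFS F) ∧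
  (∀ v ∈ varsFS H \ varsFS R.body, ∀ v' ∈ varsFS H \ varsFS R.body,
      h' v = h' v' → v = v')

/-- `L` is a result of the application `α_∨(F, R, h)` of the trigger `(R, h)` on `F`:
its `i`-th element is `F ∪ h^{safeᵢ}(Hᵢ)`. -/
def IsAlpha [DecidableEq P] [DecidableEq V] [DecidableEq C]
    (F : Finset (FOAtom P V C)) (R : DisjRule P V C) (h : FOSubst V C)
    (L : List (Finset (FOAtom P V C))) : Prop :=
  L.length = R.heads.length ∧
  ∀ (i : ℕ) (hi : i < L.length) (hi' : i < R.heads.length),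
    ∃ h' : FOSubst V C, IsSafeExt F R (R.heads.get ⟨i, hi'⟩) h h' ∧
      L.get ⟨i, hi⟩ = F ∪ applySubFS h' (R.heads.get ⟨i, hi'⟩)

/-! ## Partitions of terms (as equivalence relations), piece-unifiers -/

/-- A relation on terms, representing a partition of a set of terms (two terms are
related iff they belong to the same class). -/
abbrev TRel (V C : Type) := FOTerm V C → FOTerm V C → Prop

/-- Admissibility of a partition: no class contains two distinct constants. -/
def RelAdmissible (r : TRel V C) : Prop :=
  ∀ c c' : C, r (FOTerm.const c) (FOTerm.const c') → c = c'

/-- `u` is a substitution associated with the partition represented by `r`: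
it is constant on classes, maps each term to a member of its class (the selected term),
and gives priority to constants. -/
def IsAssocSub (r : TRel V C) (u : FOSubst V C) : Prop :=
  (∀ s t, r s t → s.applySub u = t.applySub u) ∧
  (∀ t, r t (t.applySub u)) ∧
  (∀ (v : V) (c : C), r (FOTerm.var v) (FOTerm.const c) → u v = FOTerm.const c)

/-- The data of a piece-unifier `(Q', H', P_u)`. -/
structure PieceUnif (P V C : Type) where
  Q' : Finset (FOAtom P V C)
  H' : Finset (FOAtom P V C)
  rel : TRel V C

/-- `μ` is a piece-unifier of the CQ `Q` with the conjunctive rule `B → H`. -/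
def IsPieceUnifier [DecidableEq P] [DecidableEq V] [DecidableEq C]
    (Q : Finset (FOAtom P V C)) (B H : Finset (FOAtom P V C))
    (μ : PieceUnif P V C) : Prop :=
  μ.Q'.Nonempty ∧ μ.Q' ⊆ Q ∧ μ.H' ⊆ H ∧
  Equivalence μ.rel ∧
  -- the partition is on the terms of Q' and H' (all other classes are singletons)
  (∀ s t, μ.rel s t → s = t ∨
      (s ∈ termsFS μ.Q' ∪ termsFS μ.H' ∧ t ∈ termsFS μ.Q' ∪ termsFS μ.H')) ∧
  RelAdmissible μ.rel ∧
  -- classes containing an existential variable of H' contain otherwise only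
  -- non-separating variables of Q'
  (∀ z ∈ varsFS μ.H' \ varsFS B, ∀ t, μ.rel (FOTerm.var z) t → t = FOTerm.var z ∨
      ∃ v : V, t = FOTerm.var v ∧ FOTerm.var v ∈ termsFS μ.Q' ∧ v ∉ varsFS (Q \ μ.Q')) ∧
  -- unification condition
  (∀ u : FOSubst V C, IsAssocSub μ.rel u → applySubFS u μ.Q' = applySubFS u μ.H')

/-- The join of a list of partitions (represented as relations): the equivalence
relation generated by their union. -/
def joinRel (rs : List (TRel V C)) : TRel V C :=
  Relation.EqvGen (fun s t => ∃ r ∈ rs, r s t)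

/-- The data of a disjunctive piece-unifier: the safe copies `Q₁, ..., Qₙ` together
with the conjunctive piece-unifiers `μ₁, ..., μₙ`. -/
structure DisjPieceUnif (P V C : Type) where
  Qs : List (Finset (FOAtom P V C))
  mus : List (PieceUnif P V C)

/-- The join of the partitions of a disjunctive piece-unifier. -/
def DisjPieceUnif.rel (μ : DisjPieceUnif P V C) : TRel V C :=
  joinRel (μ.mus.map PieceUnif.rel)

/-- `Qc` is a safe copy of `Q` (bijective renaming of its variables). -/
def IsSafeCopy [DecidableEq P] [DecidableEq V] [DecidableEq C]
    (Q Qc : Finset (FOAtom P V C)) : Prop :=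
  ∃ ρ : V → V, Function.Injective ρ ∧
    Qc = Q.image (FOAtom.applySub (fun v => FOTerm.var (ρ v)))

/-- `μ` is a disjunctive piece-unifier of the UCQ `𝒬` with the disjunctive rule `R`. -/
def IsDisjPieceUnifier [DecidableEq P] [DecidableEq V] [DecidableEq C]
    (𝒬 : Set (Finset (FOAtom P V C))) (R : DisjRule P V C)
    (μ : DisjPieceUnif P V C) : Prop :=
  μ.Qs.length = R.heads.length ∧ μ.mus.length = R.heads.length ∧
  -- each Qᵢ is a safe copy of a CQ of 𝒬, with variables disjoint from the rule
  -- and from the other copies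
  (∀ (i : ℕ) (hi : i < μ.Qs.length), ∃ Q ∈ 𝒬, IsSafeCopy Q (μ.Qs.get ⟨i, hi⟩)) ∧
  (∀ (i : ℕ) (hi : i < μ.Qs.length), Disjoint (varsFS (μ.Qs.get ⟨i, hi⟩)) R.vars) ∧
  (∀ (i j : ℕ) (hi : i < μ.Qs.length) (hj : j < μ.Qs.length), i ≠ j →
      Disjoint (varsFS (μ.Qs.get ⟨i, hi⟩)) (varsFS (μ.Qs.get ⟨j, hj⟩))) ∧
  -- each μᵢ is a piece-unifier of Qᵢ with B → Hᵢ
  (∀ (i : ℕ) (hi : i < R.heads.length) (hi1 : i < μ.Qs.length) (hi2 : i < μ.mus.length),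
      IsPieceUnifier (μ.Qs.get ⟨i, hi1⟩) R.body (R.heads.get ⟨i, hi⟩)
        (μ.mus.get ⟨i, hi2⟩)) ∧
  -- the join of the partitions is admissible
  RelAdmissible μ.rel

/-- `β_∨(𝒬, R, μ) = u(B) ∪ ⋃ᵢ u(Qᵢ ∖ Qᵢ')`, for `u` a substitution associated with
the join of the partitions of `μ`. -/
def betaRw [DecidableEq P] [DecidableEq V] [DecidableEq C]
    (R : DisjRule P V C) (μ : DisjPieceUnif P V C) (u : FOSubst V C) :
    Finset (FOAtom P V C) :=
  applySubFS u R.body ∪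
    (List.zipWith (fun Qi m => applySubFS u (Qi \ PieceUnif.Q' m)) μ.Qs μ.mus).foldr
      (· ∪ ·) ∅

/-! ## Semantics -/

/-- A first-order interpretation (with non-empty domain). -/
structure Interp (P V C : Type) where
  dom : Type
  nonempty : Nonempty dom
  rel : P → List dom → Prop
  cst : C → dom

def Interp.evalT (I : Interp P V C) (a : V → I.dom) : FOTerm V C → I.dom
  | FOTerm.var v => a v
  | FOTerm.const c => I.cst c

def Interp.satAtom (I : Interp P V C) (a : V → I.dom) (atm : FOAtom P V C) : Prop :=
  I.rel atm.pred (atm.args.map (I.evalT a))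

def Interp.satFS (I : Interp P V C) (a : V → I.dom) (S : Finset (FOAtom P V C)) : Prop :=
  ∀ atm ∈ S, I.satAtom a atm

/-- `I` is a model of the atom set `S` viewed as an existentially closed conjunction. -/
def Interp.modelsFB [DecidableEq V] (I : Interp P V C) (S : Finset (FOAtom P V C)) : Prop :=
  ∃ a : V → I.dom, I.satFS a S

/-- `I` satisfies the disjunctive existential rule `R`. -/
def Interp.satRule [DecidableEq V] (I : Interp P V C) (R : DisjRule P V C) : Prop :=
  ∀ a : V → I.dom, I.satFS a R.body →
    ∃ H ∈ R.heads, ∃ a' : V → I.dom,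
      (∀ v ∈ varsFS R.body, a' v = a v) ∧ I.satFS a' H

/-- First-order entailment `F, ℛ ⊨ 𝒬` of a UCQ from a fact base and a set of
disjunctive existential rules. -/
def SemEntails [DecidableEq V] (F : Finset (FOAtom P V C)) (ℛ : Set (DisjRule P V C))
    (𝒬 : Set (Finset (FOAtom P V C))) : Prop :=
  ∀ I : Interp P V C, I.modelsFB F → (∀ R ∈ ℛ, I.satRule R) →
    ∃ Q ∈ 𝒬, I.modelsFB Q

/-! ## Piece-rewriting -/

/-- `IsPieceRewriting ℛ 𝒬 𝒬'` holds when the UCQ `𝒬'` is obtained from the UCQ `𝒬`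
by a finite sequence of one-step piece-rewritings with rules of `ℛ`. -/
inductive IsPieceRewriting [DecidableEq P] [DecidableEq V] [DecidableEq C]
    (ℛ : Set (DisjRule P V C)) :
    Finset (Finset (FOAtom P V C)) → Finset (Finset (FOAtom P V C)) → Prop
  | refl (𝒬 : Finset (Finset (FOAtom P V C))) : IsPieceRewriting ℛ 𝒬 𝒬
  | step (𝒬 𝒬' : Finset (Finset (FOAtom P V C))) (R : DisjRule P V C)
      (μ : DisjPieceUnif P V C) (u : FOSubst V C) :
      IsPieceRewriting ℛ 𝒬 𝒬' → R ∈ ℛ →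
      IsDisjPieceUnifier (↑𝒬' : Set (Finset (FOAtom P V C))) R μ →
      IsAssocSub μ.rel u →
      IsPieceRewriting ℛ 𝒬 (insert (betaRw R μ u) 𝒬')

/-! ## The reduction from datalog UCQ-rewritability to disjunctive mapping
rewritability. Variables are natural numbers; `P0` is the set `𝒫` of predicates of
the datalog instance. -/

/-- The predicates of the reduction: `𝒮 = 𝒫 ∪ {T}` (constructors `base` and `T`)
and `𝒯 = {p̂ | p ∈ 𝒮} ∪ {p_{Rᵢ}}` (constructors `hat`, `hatT` and `pr`). -/
inductive RPred (P0 : Type) (n : ℕ) where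
  | base (p : P0)
  | T
  | hat (p : P0)
  | hatT
  | pr (i : Fin n)
deriving DecidableEq

/-- `p` is a source predicate (a predicate of `𝒮 = 𝒫 ∪ {T}`). -/
def RPred.isS {P0 : Type} {n : ℕ} : RPred P0 n → Prop
  | RPred.base _ => True
  | RPred.T => True
  | _ => False

/-- Renaming the predicate of an atom. -/
def FOAtom.mapPred {P P' V C : Type} (f : P → P') (a : FOAtom P V C) : FOAtom P' V C :=
  ⟨f a.pred, a.args⟩

/-- Embedding of atoms on `𝒫` as atoms on the reduction vocabulary. -/
def embedS {P0 C : Type} {n : ℕ} (a : FOAtom P0 ℕ C) : FOAtom (RPred P0 n) ℕ C :=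
  a.mapPred RPred.base

/-- The "hat" renaming of source predicates. -/
def hatFn {P0 : Type} {n : ℕ} : RPred P0 n → RPred P0 n
  | RPred.base p => RPred.hat p
  | RPred.T => RPred.hatT
  | q => q

/-- `Â`: rename all predicates of `A` with a hat. -/
def hatFS {P0 C : Type} {n : ℕ} [DecidableEq P0] [DecidableEq C]
    (S : Finset (FOAtom (RPred P0 n) ℕ C)) : Finset (FOAtom (RPred P0 n) ℕ C) :=
  S.image (FOAtom.mapPred hatFn)

/-- `A^T`: add an atom `T(t)` for every term `t` of `A`. -/
def addT {P0 C : Type} {n : ℕ} [DecidableEq P0] [DecidableEq C]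
    (S : Finset (FOAtom (RPred P0 n) ℕ C)) : Finset (FOAtom (RPred P0 n) ℕ C) :=
  S ∪ (termsFS S).image (fun t => ⟨RPred.T, [t]⟩)

/-- An atom/a set of atoms without constants. -/
def NoConstAtom {P V C : Type} (a : FOAtom P V C) : Prop :=
  ∀ t ∈ a.args, ∃ v : V, t = FOTerm.var v

def NoConstFS {P V C : Type} (S : Finset (FOAtom P V C)) : Prop :=
  ∀ a ∈ S, NoConstAtom a

/-- The frontier `x_i` of a datalog rule, as the list of the (pairwise distinct)
variables of its head atom. -/
def frontierList {P0 C : Type} (a : FOAtom P0 ℕ C) : List ℕ :=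
  (a.args.filterMap (fun t => match t with
    | FOTerm.var v => some v
    | FOTerm.const _ => none)).dedup

/-- A datalog rule `(B, H)` over `𝒫` viewed as a (disjunctive) existential rule. -/
def dlRule {P0 C : Type} (r : Finset (FOAtom P0 ℕ C) × FOAtom P0 ℕ C) :
    DisjRule P0 ℕ C :=
  ⟨r.1, [{r.2}]⟩

/-- The rule set `ℛ` viewed as a set of (disjunctive) existential rules. -/
def dlRules {P0 C : Type} (ℛ : List (Finset (FOAtom P0 ℕ C) × FOAtom P0 ℕ C)) :
    Set (DisjRule P0 ℕ C) :=
  { R | ∃ r ∈ ℛ, R = dlRule r }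

/-- The atom `p_{Rᵢ}(x_i)`. -/
def prAtom {P0 C : Type} [DecidableEq P0] [DecidableEq C]
    (ℛ : List (Finset (FOAtom P0 ℕ C) × FOAtom P0 ℕ C)) (i : Fin ℛ.length) :
    FOAtom (RPred P0 ℛ.length) ℕ C :=
  ⟨RPred.pr i, (frontierList (ℛ.get i).2).map FOTerm.var⟩

/-- The CQ `Q_{Rᵢ} = widehat((Bᵢ)^T) ∪ {p_{Rᵢ}(x_i)}`. -/
def QRi {P0 C : Type} [DecidableEq P0] [DecidableEq C]
    (ℛ : List (Finset (FOAtom P0 ℕ C) × FOAtom P0 ℕ C)) (i : Fin ℛ.length) :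
    Finset (FOAtom (RPred P0 ℛ.length) ℕ C) :=
  hatFS (addT ((ℛ.get i).1.image embedS)) ∪ {prAtom ℛ i}

/-- The CQ `Q_Q = widehat(Q^T)`. -/
def QQhat {P0 C : Type} [DecidableEq P0] [DecidableEq C] (n : ℕ)
    (Q : Finset (FOAtom P0 ℕ C)) : Finset (FOAtom (RPred P0 n) ℕ C) :=
  hatFS (addT (Q.image embedS))

/-- The UCQ `𝒬^{Q,ℛ} = {Q_Q} ∪ {Q_{Rᵢ} | Rᵢ ∈ ℛ}`. -/
def UCQred {P0 C : Type} [DecidableEq P0] [DecidableEq C]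
    (Q : Finset (FOAtom P0 ℕ C))
    (ℛ : List (Finset (FOAtom P0 ℕ C) × FOAtom P0 ℕ C)) :
    Finset (Finset (FOAtom (RPred P0 ℛ.length) ℕ C)) :=
  insert (QQhat ℛ.length Q) ((Finset.univ : Finset (Fin ℛ.length)).image (QRi ℛ))

/-- The disjunctive mapping rule `m_{Rᵢ} = T[x_i] → p_{Rᵢ}(x_i) ∨ Ĥᵢ(x_i)`. -/
def mRi {P0 C : Type} [DecidableEq P0] [DecidableEq C]
    (ℛ : List (Finset (FOAtom P0 ℕ C) × FOAtom P0 ℕ C)) (i : Fin ℛ.length) :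
    DisjRule (RPred P0 ℛ.length) ℕ C :=
  ⟨((frontierList (ℛ.get i).2).map
      (fun v => (⟨RPred.T, [FOTerm.var v]⟩ : FOAtom (RPred P0 ℛ.length) ℕ C))).toFinset,
   [{prAtom ℛ i}, {FOAtom.mapPred hatFn (embedS (ℛ.get i).2)}]⟩

/-- The translation rule `p(x⃗) → p̂(x⃗)` for `p ∈ 𝒫` (with arity `ar p`). -/
def transRule {P0 C : Type} (n : ℕ) (ar : P0 → ℕ) (p : P0) :
    DisjRule (RPred P0 n) ℕ C :=
  ⟨{⟨RPred.base p, (List.range (ar p)).map FOTerm.var⟩},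
   [{⟨RPred.hat p, (List.range (ar p)).map FOTerm.var⟩}]⟩

/-- The translation rule `T(x) → T̂(x)`. -/
def transT {P0 C : Type} (n : ℕ) : DisjRule (RPred P0 n) ℕ C :=
  ⟨{⟨RPred.T, [FOTerm.var 0]⟩}, [{⟨RPred.hatT, [FOTerm.var 0]⟩}]⟩

/-- The disjunctive mapping `ℳ^{Q,ℛ} = ℳ_ℛ ∪ ℳ_trans`. -/
def Mred {P0 C : Type} [DecidableEq P0] [DecidableEq C] (ar : P0 → ℕ)
    (ℛ : List (Finset (FOAtom P0 ℕ C) × FOAtom P0 ℕ C)) :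
    Set (DisjRule (RPred P0 ℛ.length) ℕ C) :=
  { R | ∃ i : Fin ℛ.length, R = mRi ℛ i } ∪
  { R | ∃ p : P0, R = transRule ℛ.length ar p } ∪ {transT ℛ.length}

/-- Isomorphism of CQs: bijective renaming of variables. -/
def IsoCQ {P V C : Type} [DecidableEq P] [DecidableEq V] [DecidableEq C]
    (Q₁ Q₂ : Finset (FOAtom P V C)) : Prop :=
  ∃ ρ : V → V, Function.Bijective ρ ∧
    Q₂ = Q₁.image (FOAtom.applySub (fun v => FOTerm.var (ρ v)))

/-! ## Terms, variables and substitutions -/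

theorem FOAtom.mem_varsOf [DecidableEq V] {a : FOAtom P V C} {v : V} :
    v ∈ a.varsOf ↔ FOTerm.var v ∈ a.args := by
  obtain ⟨p, l⟩ := a
  simp only [FOAtom.varsOf]
  induction l with
  | nil => simp
  | cons t l ih =>
    rw [List.foldr_cons, Finset.mem_union, List.mem_cons, ih]
    cases t <;> simp [FOTerm.varsOf]

theorem mem_varsFS [DecidableEq V] {S : Finset (FOAtom P V C)} {v : V} :
    v ∈ varsFS S ↔ ∃ a ∈ S, FOTerm.var v ∈ a.args := by
  simp [varsFS, Finset.mem_sup, FOAtom.mem_varsOf]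

theorem mem_termsFS [DecidableEq V] [DecidableEq C] {S : Finset (FOAtom P V C)}
    {t : FOTerm V C} : t ∈ termsFS S ↔ ∃ a ∈ S, t ∈ a.args := by
  simp [termsFS, Finset.mem_sup]

theorem mem_varsFS_iff_termsFS [DecidableEq V] [DecidableEq C] {S : Finset (FOAtom P V C)}
    {v : V} : v ∈ varsFS S ↔ FOTerm.var v ∈ termsFS S := by
  rw [mem_varsFS, mem_termsFS]

theorem termsFS_union [DecidableEq P] [DecidableEq V] [DecidableEq C]
    (S S' : Finset (FOAtom P V C)) : termsFS (S ∪ S') = termsFS S ∪ termsFS S' :=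
  Finset.sup_union

theorem termsFS_applySubFS [DecidableEq P] [DecidableEq V] [DecidableEq C]
    (u : FOSubst V C) (S : Finset (FOAtom P V C)) :
    termsFS (applySubFS u S) = (termsFS S).image (FOTerm.applySub u) := by
  ext t
  simp only [mem_termsFS, applySubFS, Finset.mem_image, FOAtom.applySub]
  constructor
  · rintro ⟨_, ⟨a, ha, rfl⟩, ht⟩
    obtain ⟨s, hs, rfl⟩ := List.mem_map.1 ht
    exact ⟨s, ⟨a, ha, hs⟩, rfl⟩
  · rintro ⟨s, ⟨a, ha, hs⟩, rfl⟩
    exact ⟨_, ⟨a, ha, rfl⟩, List.mem_map_of_mem hs⟩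

theorem FOTerm.applySub_comp (u u' : FOSubst V C) (t : FOTerm V C) :
    t.applySub (fun v => (u v).applySub u') = (t.applySub u).applySub u' := by
  cases t <;> rfl

theorem FOTerm.applySub_var (t : FOTerm V C) : t.applySub FOTerm.var = t := by
  cases t <;> rfl

theorem FOTerm.applySub_congr {u u' : FOSubst V C} {t : FOTerm V C}
    (h : ∀ v, t = FOTerm.var v → u v = u' v) : t.applySub u = t.applySub u' := by
  cases t with
  | var v => exact h v rfl
  | const c => rfl

theorem FOAtom.applySub_comp (u u' : FOSubst V C) (a : FOAtom P V C) :
    a.applySub (fun v => (u v).applySub u') = (a.applySub u).applySub u' := by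
  simp only [FOAtom.applySub, List.map_map, FOAtom.mk.injEq, true_and]
  exact List.map_congr_left fun t _ => FOTerm.applySub_comp u u' t

theorem FOAtom.applySub_congr {u u' : FOSubst V C} {a : FOAtom P V C}
    (h : ∀ v, FOTerm.var v ∈ a.args → u v = u' v) : a.applySub u = a.applySub u' := by
  simp only [FOAtom.applySub, FOAtom.mk.injEq, true_and]
  refine List.map_congr_left fun t ht => FOTerm.applySub_congr fun v hv => h v (hv ▸ ht)

theorem FOAtom.applySub_var (a : FOAtom P V C) : a.applySub FOTerm.var = a := by
  obtain ⟨p, l⟩ := a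
  simp only [FOAtom.applySub, FOAtom.mk.injEq, true_and]
  exact (List.map_congr_left fun t _ => FOTerm.applySub_var t).trans (List.map_id l)

theorem applySubFS_comp [DecidableEq P] [DecidableEq V] [DecidableEq C]
    (u u' : FOSubst V C) (S : Finset (FOAtom P V C)) :
    applySubFS (fun v => (u v).applySub u') S = applySubFS u' (applySubFS u S) := by
  simp only [applySubFS, Finset.image_image]
  exact Finset.image_congr fun a _ => FOAtom.applySub_comp u u' a

theorem applySubFS_congr [DecidableEq P] [DecidableEq V] [DecidableEq C]
    {u u' : FOSubst V C} {S : Finset (FOAtom P V C)} (h : ∀ v ∈ varsFS S, u v = u' v) :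
    applySubFS u S = applySubFS u' S :=
  Finset.image_congr fun a ha =>
    FOAtom.applySub_congr fun v hv => h v (mem_varsFS.2 ⟨a, ha, hv⟩)

theorem applySubFS_eq_self [DecidableEq P] [DecidableEq V] [DecidableEq C]
    {u : FOSubst V C} {S : Finset (FOAtom P V C)} (h : ∀ v ∈ varsFS S, u v = FOTerm.var v) :
    applySubFS u S = S := by
  refine (applySubFS_congr h).trans ?_
  exact (Finset.image_congr fun a _ => a.applySub_var).trans Finset.image_id

theorem applySubFS_union [DecidableEq P] [DecidableEq V] [DecidableEq C]
    (u : FOSubst V C) (S S' : Finset (FOAtom P V C)) :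
    applySubFS u (S ∪ S') = applySubFS u S ∪ applySubFS u S' :=
  Finset.image_union _ _

/-! ## Partitions and piece-unifiers -/

theorem isAssocSub_of_const_of_mem {r : TRel V C} {u : FOSubst V C}
    (h₁ : ∀ s t, r s t → s.applySub u = t.applySub u) (h₂ : ∀ t, r t (t.applySub u)) :
    IsAssocSub r u :=
  ⟨h₁, h₂, fun v c h => h₁ (FOTerm.var v) (FOTerm.const c) h⟩

theorem relAdmissible_of_const {r : TRel V C} {u : FOSubst V C}
    (h : ∀ s t, r s t → s.applySub u = t.applySub u) : RelAdmissible r :=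
  fun c c' hc => by simpa [FOTerm.applySub] using h _ _ hc

theorem joinRel_singleton {r : TRel V C} (hr : Equivalence r) : joinRel [r] = r := by
  ext s t
  simp only [joinRel, List.mem_singleton, exists_eq_left]
  exact hr.eqvGen_iff

theorem joinRel_of_mem {rs : List (TRel V C)} {r : TRel V C} (hr : r ∈ rs)
    {s t : FOTerm V C} (h : r s t) : joinRel rs s t :=
  Relation.EqvGen.rel _ _ ⟨r, hr, h⟩

theorem eq_of_joinRel {rs : List (TRel V C)} {u : FOSubst V C}
    (h : ∀ r ∈ rs, ∀ s t, r s t → s.applySub u = t.applySub u) {s t : FOTerm V C}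
    (hst : joinRel rs s t) : s.applySub u = t.applySub u := by
  induction hst with
  | rel s t hst => obtain ⟨r, hr, hst⟩ := hst; exact h r hr s t hst
  | refl s => rfl
  | symm s t _ ih => exact ih.symm
  | trans s t w _ _ ih₁ ih₂ => exact ih₁.trans ih₂

/-- The partition of terms induced by a substitution: its kernel. -/
def kerRel (π : FOSubst V C) : TRel V C := fun s t => s.applySub π = t.applySub π

theorem kerRel_equivalence (π : FOSubst V C) : Equivalence (kerRel π) :=
  ⟨fun _ => rfl, fun h => h.symm, fun h h' => h.trans h'⟩

theorem isDisjPieceUnifier_singleton [DecidableEq P] [DecidableEq V] [DecidableEq C]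
    {𝒬 : Set (Finset (FOAtom P V C))} {B H Q Q₁ : Finset (FOAtom P V C)}
    {m : PieceUnif P V C} (hQ : Q ∈ 𝒬) (hcopy : IsSafeCopy Q Q₁)
    (hdisj : Disjoint (varsFS Q₁) (DisjRule.vars ⟨B, [H]⟩))
    (hm : IsPieceUnifier Q₁ B H m) :
    IsDisjPieceUnifier 𝒬 ⟨B, [H]⟩ ⟨[Q₁], [m]⟩ := by
  have hm' := hm
  obtain ⟨-, -, -, heq, -, hadm, -⟩ := hm'
  refine ⟨rfl, rfl, ?_, ?_, ?_, ?_, ?_⟩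
  · rintro (_ | i) hi
    · exact ⟨Q, hQ, hcopy⟩
    · simp at hi
  · rintro (_ | i) hi
    · exact hdisj
    · simp at hi
  · intro i j hi hj hij
    simp at hi hj
    omega
  · rintro (_ | i) hi hi1 hi2
    · exact hm
    · simp at hi
  · change RelAdmissible (joinRel [m.rel])
    rwa [joinRel_singleton heq]

theorem isDisjPieceUnifier_pair [DecidableEq P] [DecidableEq V] [DecidableEq C]
    {𝒬 : Set (Finset (FOAtom P V C))} {B H₁ H₂ Q Q' Q₁ Q₂ : Finset (FOAtom P V C)}
    {m₁ m₂ : PieceUnif P V C} (hQ : Q ∈ 𝒬) (hcopy : IsSafeCopy Q Q₁)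
    (hQ' : Q' ∈ 𝒬) (hcopy' : IsSafeCopy Q' Q₂)
    (hdisj₁ : Disjoint (varsFS Q₁) (DisjRule.vars ⟨B, [H₁, H₂]⟩))
    (hdisj₂ : Disjoint (varsFS Q₂) (DisjRule.vars ⟨B, [H₁, H₂]⟩))
    (hdisj : Disjoint (varsFS Q₁) (varsFS Q₂))
    (hm₁ : IsPieceUnifier Q₁ B H₁ m₁) (hm₂ : IsPieceUnifier Q₂ B H₂ m₂)
    (hadm : RelAdmissible (joinRel [m₁.rel, m₂.rel])) :
    IsDisjPieceUnifier 𝒬 ⟨B, [H₁, H₂]⟩ ⟨[Q₁, Q₂], [m₁, m₂]⟩ := by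
  refine ⟨rfl, rfl, ?_, ?_, ?_, ?_, hadm⟩
  · rintro (_ | _ | i) hi
    · exact ⟨Q, hQ, hcopy⟩
    · exact ⟨Q', hQ', hcopy'⟩
    · simp at hi
  · rintro (_ | _ | i) hi
    · exact hdisj₁
    · exact hdisj₂
    · simp at hi
  · rintro (_ | _ | i) (_ | _ | j) hi hj hij
    · exact absurd rfl hij
    · exact hdisj
    · simp at hj
    · exact hdisj.symm
    · exact absurd rfl hij
    · simp at hj
    all_goals simp at hi
  · rintro (_ | _ | i) hi hi1 hi2
    · exact hm₁
    · exact hm₂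
    · simp at hi

/-- The only data of a disjunctive piece-unifier with a rule having a single disjunct. -/
theorem IsDisjPieceUnifier.exists_singleton [DecidableEq P] [DecidableEq V] [DecidableEq C]
    {𝒬 : Set (Finset (FOAtom P V C))} {B H : Finset (FOAtom P V C)}
    {μ : DisjPieceUnif P V C} (hμ : IsDisjPieceUnifier 𝒬 ⟨B, [H]⟩ μ) :
    ∃ Q ∈ 𝒬, ∃ Q₁ m, μ = ⟨[Q₁], [m]⟩ ∧ IsSafeCopy Q Q₁ ∧
      Disjoint (varsFS Q₁) (DisjRule.vars ⟨B, [H]⟩) ∧ IsPieceUnifier Q₁ B H m := by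
  obtain ⟨Qs, mus⟩ := μ
  obtain ⟨h₁, h₂, hcopy, hdisj, -, hm, -⟩ := hμ
  obtain ⟨Q₁, rfl⟩ := List.length_eq_one_iff.1 h₁
  obtain ⟨m, rfl⟩ := List.length_eq_one_iff.1 h₂
  obtain ⟨Q, hQ, hc⟩ := hcopy 0 (by simp)
  exact ⟨Q, hQ, Q₁, m, rfl, hc, hdisj 0 (by simp), hm 0 (by simp) (by simp) (by simp)⟩

/-! ## Fresh renamings of variables -/

/-- Exchange `v` and `v + N` for `v ∈ S`, fixing all other variables. -/
def shiftSwap (N : ℕ) (S : Finset ℕ) (v : ℕ) : ℕ :=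
  if v ∈ S then v + N else if N ≤ v ∧ v - N ∈ S then v - N else v

theorem shiftSwap_involutive {N : ℕ} {S : Finset ℕ} (hS : ∀ v ∈ S, v < N) :
    Function.Involutive (shiftSwap N S) := by
  intro v
  by_cases h₁ : v ∈ S
  · have h₂ : v + N ∉ S := fun h => by have := hS _ h; omega
    simp [shiftSwap, h₁, h₂]
  · by_cases h₂ : N ≤ v ∧ v - N ∈ S
    · simp only [shiftSwap, h₁, h₂, if_false, if_true, and_self]
      omega
    · simp [shiftSwap, h₁, h₂]

theorem exists_var_bound (S : Finset ℕ) : ∃ N, ∀ v ∈ S, v < N :=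
  ⟨S.sup id + 1, fun _ hv => Nat.lt_succ_of_le (Finset.le_sup (f := id) hv)⟩

theorem IsoCQ.trans [DecidableEq P] [DecidableEq V] [DecidableEq C]
    {Q₁ Q₂ Q₃ : Finset (FOAtom P V C)} (h : IsoCQ Q₁ Q₂) (h' : IsoCQ Q₂ Q₃) :
    IsoCQ Q₁ Q₃ := by
  obtain ⟨ρ, hρ, rfl⟩ := h
  obtain ⟨σ, hσ, rfl⟩ := h'
  exact ⟨σ ∘ ρ, hσ.comp hρ,
    (applySubFS_comp (fun v => FOTerm.var (ρ v)) (fun v => FOTerm.var (σ v)) Q₁).symm⟩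

theorem IsoCQ.refl [DecidableEq P] [DecidableEq V] [DecidableEq C]
    (Q : Finset (FOAtom P V C)) : IsoCQ Q Q :=
  ⟨id, Function.bijective_id, (applySubFS_eq_self fun _ _ => rfl).symm⟩

/-! ## Translating predicates by rules `p(x⃗) → q(x⃗)` -/

/-- The rule `p(x₁, ..., x_k) → q(x₁, ..., x_k)`. -/
def copyRule (p q : P) (k : ℕ) : DisjRule P ℕ C :=
  ⟨{⟨p, (List.range k).map FOTerm.var⟩}, [{⟨q, (List.range k).map FOTerm.var⟩}]⟩

theorem lt_of_mem_vars_copyRule {p q : P} {k v : ℕ}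
    (hv : v ∈ (copyRule p q k : DisjRule P ℕ C).vars) : v < k := by
  simpa [DisjRule.vars, copyRule, mem_varsFS] using hv

/-- The substitution of the variables `0, ..., k - 1` by the terms of a list. -/
def listSub (ts : List (FOTerm ℕ C)) : FOSubst ℕ C := fun v => ts.getD v (FOTerm.var v)

theorem map_listSub (ts : List (FOTerm ℕ C)) :
    ((List.range ts.length).map FOTerm.var).map (FOTerm.applySub (listSub ts)) = ts := by
  refine List.ext_getElem (by simp) fun i h₁ h₂ => ?_
  simp [FOTerm.applySub, listSub, h₂]

/-- Rewriting one atom of a CQ with a copy rule. -/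
theorem IsPieceRewriting.copyRule_step [DecidableEq P] [DecidableEq C]
    {ℳ : Set (DisjRule P ℕ C)} {𝒬 𝒬' : Finset (Finset (FOAtom P ℕ C))}
    (h : IsPieceRewriting ℳ 𝒬 𝒬') {F F₁ : Finset (FOAtom P ℕ C)} (hF : F ∈ 𝒬')
    (hcopy : IsSafeCopy F F₁) {p q : P} {ts : List (FOTerm ℕ C)}
    (hR : copyRule p q ts.length ∈ ℳ) (ha : ⟨q, ts⟩ ∈ F₁)
    (hfresh : ∀ v ∈ varsFS F₁, ts.length ≤ v) :
    IsPieceRewriting ℳ 𝒬 (insert ({⟨p, ts⟩} ∪ F₁ \ {⟨q, ts⟩}) 𝒬') := by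
  set a : FOAtom P ℕ C := ⟨q, ts⟩ with ha_def
  set xs : List (FOTerm ℕ C) := (List.range ts.length).map FOTerm.var with hxs
  set m : PieceUnif P ℕ C := ⟨{a}, {⟨q, xs⟩}, kerRel (listSub ts)⟩ with hm_def
  have hfix : ∀ v, ts.length ≤ v → listSub ts v = FOTerm.var v := fun v hv => by
    simp [listSub, hv]
  have hlist : ∀ v, v < ts.length → listSub ts v ∈ ts := fun v hv => by
    simp [listSub, hv]
  have hts : ∀ t ∈ ts, t.applySub (listSub ts) = t := by
    intro t ht
    conv_rhs => rw [← t.applySub_var]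
    refine FOTerm.applySub_congr fun v hv => hfix v (hfresh v ?_)
    exact mem_varsFS.2 ⟨a, ha, hv ▸ ht⟩
  have hidem : ∀ t : FOTerm ℕ C,
      (t.applySub (listSub ts)).applySub (listSub ts) = t.applySub (listSub ts) := by
    rintro (v | c)
    · by_cases hv : v < ts.length
      · exact hts _ (hlist v hv)
      · simp [FOTerm.applySub, hfix v (not_lt.1 hv)]
    · rfl
  have hclass : ∀ t : FOTerm ℕ C, t.applySub (listSub ts) = t ∨
      (t ∈ xs ∧ t.applySub (listSub ts) ∈ ts) := by
    rintro (v | c)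
    · by_cases hv : v < ts.length
      · exact Or.inr ⟨by simp [hxs, hv], hlist v hv⟩
      · exact Or.inl (hfix v (not_lt.1 hv))
    · exact Or.inl rfl
  have hterms : termsFS m.Q' ∪ termsFS m.H' = ts.toFinset ∪ xs.toFinset := by
    simp [hm_def, termsFS, ha_def]
  have hm : IsPieceUnifier F₁ {⟨p, xs⟩} {⟨q, xs⟩} m := by
    refine ⟨by simp [hm_def], by simpa [hm_def] using ha, by simp [hm_def],
      kerRel_equivalence _, ?_, relAdmissible_of_const fun s t hst => hst, ?_, ?_⟩
    · intro s t hst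
      have hst : s.applySub (listSub ts) = t.applySub (listSub ts) := hst
      rw [hterms]
      simp only [Finset.mem_union, List.mem_toFinset]
      rcases hclass s with hs | ⟨hs, hs'⟩ <;> rcases hclass t with ht | ⟨ht, ht'⟩
      · exact Or.inl (by rw [← hs, hst, ht])
      · exact Or.inr ⟨Or.inl (by rwa [← hs, hst]), Or.inr ht⟩
      · exact Or.inr ⟨Or.inr hs, Or.inl (by rwa [← ht, ← hst])⟩
      · exact Or.inr ⟨Or.inr hs, Or.inr ht⟩
    · intro z hz
      simp [hm_def, varsFS, FOAtom.varsOf] at hz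
    · intro u hu
      have hmap : ts.map (FOTerm.applySub u) = xs.map (FOTerm.applySub u) := by
        conv_lhs => rw [← map_listSub ts, List.map_map]
        exact List.map_congr_left fun t _ => hu.1 _ _ (hidem t)
      simp [hm_def, applySubFS, FOAtom.applySub, ha_def, hmap]
  have hμ : IsDisjPieceUnifier (↑𝒬' : Set _) (copyRule p q ts.length) ⟨[F₁], [m]⟩ := by
    refine isDisjPieceUnifier_singleton hF hcopy ?_ hm
    rw [Finset.disjoint_left]
    intro v hv hv'
    exact absurd (lt_of_mem_vars_copyRule hv') (not_lt.2 (hfresh v hv))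
  have hu : IsAssocSub (DisjPieceUnif.rel ⟨[F₁], [m]⟩) (listSub ts) := by
    change IsAssocSub (joinRel [m.rel]) _
    rw [joinRel_singleton hm.2.2.2.1]
    exact isAssocSub_of_const_of_mem (fun s t hst => hst) fun t => (hidem t).symm
  have hβ : betaRw (copyRule p q ts.length) ⟨[F₁], [m]⟩ (listSub ts) =
      {⟨p, ts⟩} ∪ F₁ \ {a} := by
    have h₁ : applySubFS (listSub ts) (F₁ \ {a}) = F₁ \ {a} := by
      refine applySubFS_eq_self fun v hv => hfix v (hfresh v ?_)
      obtain ⟨b, hb, hvb⟩ := mem_varsFS.1 hv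
      exact mem_varsFS.2 ⟨b, (Finset.mem_sdiff.1 hb).1, hvb⟩
    have h₂ : applySubFS (listSub ts) {(⟨p, xs⟩ : FOAtom P ℕ C)} = {⟨p, ts⟩} := by
      simp [applySubFS, FOAtom.applySub, hxs, map_listSub, -List.map_map]
    simp only [betaRw, copyRule, List.zipWith, List.foldr, Finset.union_empty]
    rw [← hxs, h₂, hm_def, h₁]
  rw [← hβ]
  exact h.step _ _ _ _ _ hR hμ hu

/-- If every predicate changed by the idempotent map `f` can be rewritten by a copy rule,
then a CQ can be rewritten, up to isomorphism, into its image under `f`. -/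
theorem IsPieceRewriting.exists_mapPred [DecidableEq P] [DecidableEq C]
    {ℳ : Set (DisjRule P ℕ C)} {𝒬 : Finset (Finset (FOAtom P ℕ C))} {f : P → P}
    (hf : ∀ p, f (f p) = f p) (n : ℕ) :
    ∀ {𝒬' : Finset (Finset (FOAtom P ℕ C))}, IsPieceRewriting ℳ 𝒬 𝒬' →
    ∀ F ∈ 𝒬', (∀ a ∈ F, f a.pred ≠ a.pred → copyRule (f a.pred) a.pred a.args.length ∈ ℳ) →
      (F.filter fun a => f a.pred ≠ a.pred).card ≤ n →
      ∃ 𝒬₂, IsPieceRewriting ℳ 𝒬 𝒬₂ ∧ ∃ Q₂ ∈ 𝒬₂, IsoCQ (F.image (FOAtom.mapPred f)) Q₂ := by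
  induction n with
  | zero =>
    intro 𝒬' h F hF _ hcard
    have hfilter : ∀ a ∈ F, f a.pred = a.pred := by
      simpa [Finset.filter_eq_empty_iff] using hcard
    have hFf : F.image (FOAtom.mapPred f) = F := by
      refine (Finset.image_congr fun a ha => ?_).trans Finset.image_id
      obtain ⟨p, ts⟩ := a
      simpa [FOAtom.mapPred] using hfilter _ ha
    rw [hFf]
    exact ⟨𝒬', h, F, hF, IsoCQ.refl F⟩
  | succ n ih =>
    intro 𝒬' h F hF hrule hcard
    by_cases hne : ∃ a ∈ F, f a.pred ≠ a.pred
    swap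
    · refine ih h F hF hrule ?_
      push Not at hne
      simp [Finset.filter_eq_empty_iff.2 fun a ha => not_not.2 (hne a ha)]
    obtain ⟨⟨q, ts⟩, ha, hq⟩ := hne
    obtain ⟨N, hN⟩ := exists_var_bound (varsFS F ∪ {ts.length})
    have hN' : ∀ v ∈ varsFS F, v < N := fun v hv => hN v (Finset.mem_union_left _ hv)
    have hlen : ts.length < N := hN _ (by simp)
    set ρ := shiftSwap N (varsFS F)
    have hρ : Function.Bijective ρ := (shiftSwap_involutive hN').bijective
    set σ : FOSubst ℕ C := fun v => FOTerm.var (ρ v) with hσ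
    have hcopy : IsSafeCopy F (applySubFS σ F) := ⟨ρ, hρ.1, rfl⟩
    set ts' := ts.map (FOTerm.applySub σ) with hts'
    have ha' : (⟨q, ts'⟩ : FOAtom P ℕ C) ∈ applySubFS σ F :=
      Finset.mem_image_of_mem (FOAtom.applySub σ) ha
    have hlen' : ts'.length = ts.length := by simp [hts']
    have hfresh : ∀ v ∈ varsFS (applySubFS σ F), ts'.length ≤ v := by
      intro v hv
      rw [mem_varsFS_iff_termsFS, termsFS_applySubFS] at hv
      obtain ⟨w | c, hw, hwv⟩ := Finset.mem_image.1 hv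
      · have hw' := mem_varsFS_iff_termsFS.2 hw
        have : w + N = v := by
          simpa [FOTerm.applySub, hσ, ρ, shiftSwap, hw'] using hwv
        omega
      · cases hwv
    have hstep := h.copyRule_step hF hcopy (p := f q) (q := q) (ts := ts')
      (by rw [hlen']; exact hrule _ ha hq) ha' hfresh
    set F₂ : Finset (FOAtom P ℕ C) := {⟨f q, ts'⟩} ∪ applySubFS σ F \ {⟨q, ts'⟩} with hF₂
    have hrule₂ : ∀ a ∈ F₂, f a.pred ≠ a.pred →
        copyRule (f a.pred) a.pred a.args.length ∈ ℳ := by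
      intro b hb hfb
      rcases Finset.mem_union.1 hb with hb | hb
      · rw [Finset.mem_singleton] at hb
        subst hb
        exact absurd (hf q) hfb
      · obtain ⟨c, hc, rfl⟩ := Finset.mem_image.1 (Finset.mem_sdiff.1 hb).1
        simpa [FOAtom.applySub] using hrule c hc hfb
    have hcard₂ : (F₂.filter fun a => f a.pred ≠ a.pred).card ≤ n := by
      have hsub : (F₂.filter fun a => f a.pred ≠ a.pred) ⊆
          ((F.filter fun a => f a.pred ≠ a.pred).image (FOAtom.applySub σ)).erase
            ⟨q, ts'⟩ := by
        intro b hb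
        obtain ⟨hb, hfb⟩ := Finset.mem_filter.1 hb
        rcases Finset.mem_union.1 hb with hb | hb
        · rw [Finset.mem_singleton] at hb
          subst hb
          exact absurd (hf q) hfb
        · obtain ⟨hb, hbq⟩ := Finset.mem_sdiff.1 hb
          obtain ⟨c, hc, rfl⟩ := Finset.mem_image.1 hb
          exact Finset.mem_erase.2 ⟨by simpa using hbq,
            Finset.mem_image_of_mem _ (Finset.mem_filter.2 ⟨hc, hfb⟩)⟩
      have hmem : (⟨q, ts'⟩ : FOAtom P ℕ C) ∈
          (F.filter fun a => f a.pred ≠ a.pred).image (FOAtom.applySub σ) :=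
        Finset.mem_image_of_mem (FOAtom.applySub σ) (Finset.mem_filter.2 ⟨ha, hq⟩)
      have h₁ := Finset.card_le_card hsub
      have h₂ := Finset.card_erase_lt_of_mem hmem
      have h₃ := Finset.card_image_le (s := F.filter fun a => f a.pred ≠ a.pred)
        (f := FOAtom.applySub σ)
      omega
    obtain ⟨𝒬₂, h𝒬₂, Q₂, hQ₂, hiso⟩ :=
      ih hstep F₂ (Finset.mem_insert_self _ _) hrule₂ hcard₂
    refine ⟨𝒬₂, h𝒬₂, Q₂, hQ₂, IsoCQ.trans ⟨ρ, hρ, ?_⟩ hiso⟩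
    have hFσ : applySubFS σ F = {⟨q, ts'⟩} ∪ applySubFS σ F \ {⟨q, ts'⟩} := by
      rw [Finset.union_sdiff_of_subset (Finset.singleton_subset_iff.2 ha')]
    have hF₂σ : F₂.image (FOAtom.mapPred f) = (applySubFS σ F).image (FOAtom.mapPred f) := by
      conv_rhs => rw [hFσ]
      rw [hF₂, Finset.image_union, Finset.image_union]
      simp [FOAtom.mapPred, hf]
    rw [hF₂σ, applySubFS, Finset.image_image, Finset.image_image]
    rfl

theorem IsPieceRewriting.subset [DecidableEq P] [DecidableEq V] [DecidableEq C]
    {ℳ : Set (DisjRule P V C)} {𝒬 𝒬' : Finset (Finset (FOAtom P V C))}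
    (h : IsPieceRewriting ℳ 𝒬 𝒬') : 𝒬 ⊆ 𝒬' := by
  induction h with
  | refl => exact subset_rfl
  | step 𝒬' R μ u _ _ _ _ ih => exact ih.trans (Finset.subset_insert _ _)

/-! ## The reduction -/

section Reduction

variable {P0 : Type}

theorem termsFS_image_mapPred {P' : Type} [DecidableEq P'] [DecidableEq C] (f : P0 → P')
    (S : Finset (FOAtom P0 ℕ C)) : termsFS (S.image (FOAtom.mapPred f)) = termsFS S := by
  ext t
  simp [mem_termsFS, FOAtom.mapPred]

theorem mem_frontierList {a : FOAtom P0 ℕ C} {v : ℕ} :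
    v ∈ frontierList a ↔ FOTerm.var v ∈ a.args := by
  simp only [frontierList, List.mem_dedup, List.mem_filterMap]
  constructor
  · rintro ⟨w | c, hw, h⟩
    · cases h
      exact hw
    · cases h
  · exact fun h => ⟨_, h, rfl⟩

/-- The inverse of the hat renaming, fixing the predicates without a hat. -/
def unhatFn {n : ℕ} : RPred P0 n → RPred P0 n
  | RPred.hat p => RPred.base p
  | RPred.hatT => RPred.T
  | q => q

theorem unhatFn_unhatFn {n : ℕ} (q : RPred P0 n) : unhatFn (unhatFn q) = unhatFn q := by
  cases q <;> rfl

variable [DecidableEq P0] [DecidableEq C]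

theorem applySubFS_image_mapPred {P' : Type} [DecidableEq P'] (f : P0 → P')
    (u : FOSubst ℕ C) (S : Finset (FOAtom P0 ℕ C)) :
    applySubFS u (S.image (FOAtom.mapPred f)) = (applySubFS u S).image (FOAtom.mapPred f) := by
  simp only [applySubFS, Finset.image_image]
  rfl

/-- The set of atoms `q(t)` for `t ∈ X`. -/
def unaryAtoms {n : ℕ} (q : RPred P0 n) (X : Finset (FOTerm ℕ C)) :
    Finset (FOAtom (RPred P0 n) ℕ C) :=
  X.image fun t => ⟨q, [t]⟩

theorem mem_unaryAtoms {n : ℕ} {q : RPred P0 n} {X : Finset (FOTerm ℕ C)}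
    {a : FOAtom (RPred P0 n) ℕ C} : a ∈ unaryAtoms q X ↔ ∃ t ∈ X, ⟨q, [t]⟩ = a :=
  Finset.mem_image

theorem unaryAtoms_union {n : ℕ} (q : RPred P0 n) (X Y : Finset (FOTerm ℕ C)) :
    unaryAtoms q (X ∪ Y) = unaryAtoms q X ∪ unaryAtoms q Y :=
  Finset.image_union _ _

theorem applySubFS_unaryAtoms {n : ℕ} (u : FOSubst ℕ C) (q : RPred P0 n)
    (X : Finset (FOTerm ℕ C)) :
    applySubFS u (unaryAtoms q X) = unaryAtoms q (X.image (FOTerm.applySub u)) := by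
  simp only [applySubFS, unaryAtoms, Finset.image_image]
  rfl

theorem termsFS_unaryAtoms {n : ℕ} (q : RPred P0 n) (X : Finset (FOTerm ℕ C)) :
    termsFS (unaryAtoms q X) = X := by
  ext t
  simp [mem_termsFS, mem_unaryAtoms]

/-- The CQ `widehat(Q^T)` extended with the atoms `T(t)` for `t ∈ X`. -/
def hatCQ (n : ℕ) (Q : Finset (FOAtom P0 ℕ C)) (X : Finset (FOTerm ℕ C)) :
    Finset (FOAtom (RPred P0 n) ℕ C) :=
  Q.image (FOAtom.mapPred RPred.hat) ∪ unaryAtoms RPred.hatT (termsFS Q) ∪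
    unaryAtoms RPred.T X

theorem addT_image_embedS (n : ℕ) (Q : Finset (FOAtom P0 ℕ C)) :
    addT (n := n) (Q.image embedS) =
      Q.image (FOAtom.mapPred RPred.base) ∪ unaryAtoms RPred.T (termsFS Q) := by
  change _ ∪ (termsFS (Q.image (FOAtom.mapPred RPred.base))).image _ = _
  rw [termsFS_image_mapPred]
  rfl

theorem hatFS_addT_image_embedS (n : ℕ) (Q : Finset (FOAtom P0 ℕ C)) :
    hatFS (addT (n := n) (Q.image embedS)) = hatCQ n Q ∅ := by
  rw [addT_image_embedS, hatFS, Finset.image_union, Finset.image_image, hatCQ, unaryAtoms,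
    unaryAtoms, unaryAtoms, Finset.image_image, Finset.image_empty, Finset.union_empty]
  rfl

theorem applySubFS_hatCQ (n : ℕ) (u : FOSubst ℕ C) (Q : Finset (FOAtom P0 ℕ C))
    (X : Finset (FOTerm ℕ C)) :
    applySubFS u (hatCQ n Q X) =
      hatCQ n (applySubFS u Q) (X.image (FOTerm.applySub u)) := by
  simp only [hatCQ, applySubFS_union, applySubFS_unaryAtoms, applySubFS_image_mapPred,
    termsFS_applySubFS]

theorem termsFS_hatCQ (n : ℕ) (Q : Finset (FOAtom P0 ℕ C)) (X : Finset (FOTerm ℕ C)) :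
    termsFS (hatCQ n Q X) = termsFS Q ∪ X := by
  simp only [hatCQ, termsFS_union, termsFS_unaryAtoms, termsFS_image_mapPred,
    Finset.union_self]

theorem pred_ne_pr_of_mem_hatCQ {n : ℕ} {Q : Finset (FOAtom P0 ℕ C)}
    {X : Finset (FOTerm ℕ C)} {a : FOAtom (RPred P0 n) ℕ C} (ha : a ∈ hatCQ n Q X)
    (i : Fin n) : a.pred ≠ RPred.pr i := by
  simp only [hatCQ, Finset.mem_union, Finset.mem_image, mem_unaryAtoms] at ha
  rcases ha with (⟨b, -, rfl⟩ | ⟨t, -, rfl⟩) | ⟨t, -, rfl⟩ <;> simp [FOAtom.mapPred]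

theorem hatCQ_sdiff (n : ℕ) (Q Q' : Finset (FOAtom P0 ℕ C)) (X : Finset (FOTerm ℕ C)) :
    hatCQ n Q X \ Q'.image (FOAtom.mapPred RPred.hat) =
      (Q \ Q').image (FOAtom.mapPred RPred.hat) ∪ unaryAtoms RPred.hatT (termsFS Q) ∪
        unaryAtoms RPred.T X := by
  have hinj : Function.Injective
      (FOAtom.mapPred (V := ℕ) (C := C) (RPred.hat (P0 := P0) (n := n))) := by
    rintro ⟨p, ts⟩ ⟨q, ss⟩ h
    simpa [FOAtom.mapPred] using h
  have hdisj : ∀ (q : RPred P0 n) (Y : Finset (FOTerm ℕ C)), (∀ p, q ≠ RPred.hat p) →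
      unaryAtoms q Y \ Q'.image (FOAtom.mapPred RPred.hat) = unaryAtoms q Y := by
    intro q Y hq
    rw [Finset.sdiff_eq_self_iff_disjoint, Finset.disjoint_left]
    intro a ha ha'
    obtain ⟨t, -, rfl⟩ := mem_unaryAtoms.1 ha
    obtain ⟨b, -, hb⟩ := Finset.mem_image.1 ha'
    exact hq _ (congrArg FOAtom.pred hb).symm
  rw [hatCQ, Finset.union_sdiff_distrib, Finset.union_sdiff_distrib,
    hdisj _ _ (by simp), hdisj _ _ (by simp), Finset.image_sdiff _ _ hinj]

theorem QRi_eq (ℛ : List (Finset (FOAtom P0 ℕ C) × FOAtom P0 ℕ C)) (i : Fin ℛ.length) :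
    QRi ℛ i = hatCQ ℛ.length (ℛ.get i).1 ∅ ∪ {prAtom ℛ i} := by
  rw [QRi, hatFS_addT_image_embedS]

theorem mRi_body (ℛ : List (Finset (FOAtom P0 ℕ C) × FOAtom P0 ℕ C)) (i : Fin ℛ.length) :
    (mRi ℛ i).body =
      unaryAtoms RPred.T ((frontierList (ℛ.get i).2).toFinset.image FOTerm.var) := by
  ext a
  simp [mRi, unaryAtoms]

theorem varsFS_mRi_body (ℛ : List (Finset (FOAtom P0 ℕ C) × FOAtom P0 ℕ C))
    (i : Fin ℛ.length) : varsFS (mRi ℛ i).body = (frontierList (ℛ.get i).2).toFinset := by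
  ext v
  rw [mem_varsFS_iff_termsFS, mRi_body, termsFS_unaryAtoms]
  simp

theorem mem_vars_mRi {ℛ : List (Finset (FOAtom P0 ℕ C) × FOAtom P0 ℕ C)}
    {i : Fin ℛ.length} {v : ℕ} :
    v ∈ (mRi ℛ i).vars ↔ v ∈ frontierList (ℛ.get i).2 := by
  rw [DisjRule.vars, varsFS_mRi_body]
  simp [mRi, mem_varsFS, prAtom, FOAtom.mapPred, embedS, mem_frontierList]

/-- A rewriting step with a datalog rule `Rᵢ` is simulated by a rewriting step with the
disjunctive mapping rule of `Rᵢ`. -/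
theorem IsPieceRewriting.mRi_step {ar : P0 → ℕ} {Q : Finset (FOAtom P0 ℕ C)}
    {ℛ : List (Finset (FOAtom P0 ℕ C) × FOAtom P0 ℕ C)} {i : Fin ℛ.length}
    {B : Finset (FOAtom P0 ℕ C)} {H : FOAtom P0 ℕ C} (hi : ℛ.get i = (B, H))
    (hHB : H.varsOf ⊆ varsFS B) (hH : NoConstAtom H)
    {𝒬 : Finset (Finset (FOAtom (RPred P0 ℛ.length) ℕ C))}
    (h : IsPieceRewriting (Mred ar ℛ) (UCQred Q ℛ) 𝒬)
    {Q₀ Q₁ : Finset (FOAtom P0 ℕ C)} {X : Finset (FOTerm ℕ C)}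
    (hQ₀ : hatCQ ℛ.length Q₀ X ∈ 𝒬) (hX : X ⊆ termsFS Q₀) (hcopy : IsSafeCopy Q₀ Q₁)
    (hdisj : Disjoint (varsFS Q₁) (DisjRule.vars ⟨B, [{H}]⟩))
    {m : PieceUnif P0 ℕ C} (hm : IsPieceUnifier Q₁ B {H} m)
    {u : FOSubst ℕ C} (hu : IsAssocSub m.rel u) :
    ∃ X', X' ⊆ termsFS (applySubFS u B ∪ applySubFS u (Q₁ \ m.Q')) ∧
      IsPieceRewriting (Mred ar ℛ) (UCQred Q ℛ)
        (insert (hatCQ ℛ.length (applySubFS u B ∪ applySubFS u (Q₁ \ m.Q')) X') 𝒬) := by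
  obtain ⟨hne, hsub, hsubH, heq, hcls, hadm, -, hunif⟩ := hm
  obtain ⟨ρ₀, hρ₀, hQ₁⟩ := hcopy
  change Q₁ = applySubFS (fun v => FOTerm.var (ρ₀ v)) Q₀ at hQ₁
  set X₁ := X.image (FOTerm.applySub fun v => FOTerm.var (ρ₀ v)) with hX₁
  have hX₁Q₁ : X₁ ⊆ termsFS Q₁ := by
    rw [hQ₁, termsFS_applySubFS]
    exact Finset.image_subset_image hX
  set fr := (frontierList H).toFinset with hfr
  have hmem_fr : ∀ v, v ∈ fr ↔ FOTerm.var v ∈ H.args := fun v => by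
    rw [hfr, List.mem_toFinset, mem_frontierList]
  have hfrB : fr ⊆ varsFS B := fun v hv => hHB (FOAtom.mem_varsOf.2 ((hmem_fr v).1 hv))
  have hQ₁B : ∀ v ∈ varsFS Q₁, v ∉ varsFS B := fun v hv hvB =>
    Finset.disjoint_left.1 hdisj hv (Finset.mem_union_left _ hvB)
  obtain ⟨N, hN⟩ := exists_var_bound (varsFS Q₁ ∪ varsFS B)
  have hNQ : ∀ v ∈ varsFS Q₁, v < N := fun v hv => hN v (Finset.mem_union_left _ hv)
  have hNB : ∀ v ∈ varsFS B, v < N := fun v hv => hN v (Finset.mem_union_right _ hv)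
  have hNfr : ∀ v ∈ fr, v < N := fun v hv => hNB v (hfrB hv)
  set ρ := shiftSwap N fr
  have hρ : Function.Injective ρ := (shiftSwap_involutive hNfr).injective
  set σ : FOSubst ℕ C := fun v => FOTerm.var (ρ v) with hσ
  have hσfr : ∀ v ∈ fr, σ v = FOTerm.var (v + N) := fun v hv => by
    simp [hσ, ρ, shiftSwap, hv]
  have hσB : ∀ v, v < N → v ∉ fr → σ v = FOTerm.var v := fun v hv hv' => by
    simp [hσ, ρ, shiftSwap, hv', not_le.2 hv]
  set π : FOSubst ℕ C := fun v =>
    if N ≤ v ∧ v - N ∈ fr then FOTerm.var (v - N) else FOTerm.var v with hπ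
  have hπfix : ∀ v, v < N → π v = FOTerm.var v := fun v hv => by
    simp [hπ, not_le.2 hv]
  have hπσ : ∀ v, v < N → (σ v).applySub π = FOTerm.var v := by
    intro v hv
    by_cases hvfr : v ∈ fr
    · simp [hσfr v hvfr, FOTerm.applySub, hπ, hvfr]
    · rw [hσB v hv hvfr]
      exact hπfix v hv
  set u' : FOSubst ℕ C := fun v => (π v).applySub u with hu'
  have hu'π : ∀ t : FOTerm ℕ C, t.applySub u' = (t.applySub π).applySub u :=
    FOTerm.applySub_comp π u
  have hu'fix : ∀ v, v < N → u' v = u v := fun v hv => by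
    simp [hu', hπfix v hv, FOTerm.applySub]
  -- terms of the unified part of the CQ are mapped to terms of the rewritten body
  have hHterm : ∀ t ∈ H.args, t.applySub u ∈ termsFS (applySubFS u B) := by
    intro t ht
    obtain ⟨v, rfl⟩ := hH t ht
    rw [termsFS_applySubFS]
    exact Finset.mem_image_of_mem _
      (mem_varsFS_iff_termsFS.1 (hfrB ((hmem_fr v).2 ht)))
  have hterms : ∀ t ∈ termsFS Q₁, t.applySub u ∈
      termsFS (applySubFS u B ∪ applySubFS u (Q₁ \ m.Q')) := by
    intro t ht
    rw [termsFS_union]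
    obtain ⟨a, ha, hta⟩ := mem_termsFS.1 ht
    by_cases haQ : a ∈ m.Q'
    · have hmem : a.applySub u ∈ applySubFS u m.H' := by
        rw [← hunif u hu]
        exact Finset.mem_image_of_mem _ haQ
      obtain ⟨b, hb, hba⟩ := Finset.mem_image.1 hmem
      rw [Finset.mem_singleton.1 (hsubH hb)] at hba
      have htu : t.applySub u ∈ (H.applySub u).args := by
        rw [hba]
        exact List.mem_map_of_mem hta
      obtain ⟨s, hs, hst⟩ := List.mem_map.1 htu
      rw [← hst]
      exact Finset.mem_union_left _ (hHterm s hs)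
    · refine Finset.mem_union_right _ ?_
      rw [termsFS_applySubFS]
      exact Finset.mem_image_of_mem _
        (mem_termsFS.2 ⟨a, Finset.mem_sdiff.2 ⟨ha, haQ⟩, hta⟩)
  set X' := (fr.image FOTerm.var).image (FOTerm.applySub u) ∪ X₁.image (FOTerm.applySub u)
    with hX'
  refine ⟨X', ?_, ?_⟩
  · rw [hX', Finset.union_subset_iff]
    constructor
    · intro t ht
      simp only [Finset.mem_image, exists_exists_and_eq_and] at ht
      obtain ⟨v, hv, rfl⟩ := ht
      rw [termsFS_union]
      exact Finset.mem_union_left _ (hHterm _ ((hmem_fr v).1 hv))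
    · intro t ht
      obtain ⟨s, hs, rfl⟩ := Finset.mem_image.1 ht
      exact hterms s (hX₁Q₁ hs)
  set p : FOAtom (RPred P0 ℛ.length) ℕ C := (prAtom ℛ i).applySub σ with hp
  have hprargs : (prAtom ℛ i).args = (frontierList H).map FOTerm.var := by
    rw [prAtom, hi]
  set R₁ := hatCQ ℛ.length (applySubFS σ B) ∅ ∪ {p} with hR₁
  set R₂ := hatCQ ℛ.length Q₁ X₁ with hR₂
  set m₁ : PieceUnif (RPred P0 ℛ.length) ℕ C := ⟨{p}, {prAtom ℛ i}, kerRel π⟩ with hm₁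
  set m₂ : PieceUnif (RPred P0 ℛ.length) ℕ C :=
    ⟨m.Q'.image (FOAtom.mapPred RPred.hat), m.H'.image (FOAtom.mapPred RPred.hat), m.rel⟩
    with hm₂
  have hbody : varsFS (mRi ℛ i).body = fr := by rw [varsFS_mRi_body, hi]
  have hpterm : ∀ v ∈ fr, FOTerm.var (v + N) ∈ p.args := by
    intro v hv
    rw [hp, FOAtom.applySub, hprargs, List.map_map]
    exact List.mem_map.2 ⟨v, List.mem_toFinset.1 hv, hσfr v hv⟩
  have hunif₁ : IsPieceUnifier R₁ (mRi ℛ i).body {prAtom ℛ i} m₁ := by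
    refine ⟨by simp [hm₁], by simp [hm₁, hR₁], by simp [hm₁], kerRel_equivalence π, ?_,
      relAdmissible_of_const fun s t hst => hst, ?_, ?_⟩
    · have hmoved : ∀ t : FOTerm ℕ C, t.applySub π = t ∨
          ∃ v ∈ fr, t = FOTerm.var (v + N) ∧ t.applySub π = FOTerm.var v := by
        rintro (v | c)
        · by_cases hv : N ≤ v ∧ v - N ∈ fr
          · exact Or.inr ⟨v - N, hv.2, by rw [Nat.sub_add_cancel hv.1],
              by simp [FOTerm.applySub, hπ, hv]⟩
          · exact Or.inl (by simp only [FOTerm.applySub, hπ, hv, if_false])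
        · exact Or.inl rfl
      have hin₁ : ∀ v ∈ fr, FOTerm.var (v + N) ∈ termsFS m₁.Q' ∪ termsFS m₁.H' :=
        fun v hv => Finset.mem_union_left _
          (mem_termsFS.2 ⟨p, Finset.mem_singleton_self _, hpterm v hv⟩)
      have hin₂ : ∀ v ∈ fr, FOTerm.var v ∈ termsFS m₁.Q' ∪ termsFS m₁.H' := by
        refine fun v hv => Finset.mem_union_right _
          (mem_termsFS.2 ⟨prAtom ℛ i, Finset.mem_singleton_self _, ?_⟩)
        rw [hprargs]
        exact List.mem_map_of_mem (List.mem_toFinset.1 hv)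
      intro s t hst
      have hst : s.applySub π = t.applySub π := hst
      rcases hmoved s with hs | ⟨v, hv, hs, hs'⟩ <;>
        rcases hmoved t with ht | ⟨w, hw, ht, ht'⟩
      · exact Or.inl (by rw [← hs, hst, ht])
      · refine Or.inr ⟨?_, ht ▸ hin₁ w hw⟩
        rw [← hs, hst, ht']
        exact hin₂ w hw
      · refine Or.inr ⟨hs ▸ hin₁ v hv, ?_⟩
        rw [← ht, ← hst, hs']
        exact hin₂ v hv
      · exact Or.inr ⟨hs ▸ hin₁ v hv, ht ▸ hin₁ w hw⟩
    · intro z hz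
      obtain ⟨hz, hz'⟩ := Finset.mem_sdiff.1 hz
      obtain ⟨a, ha, hza⟩ := mem_varsFS.1 hz
      rw [Finset.mem_singleton.1 ha, hprargs] at hza
      rw [hbody] at hz'
      exact absurd (by simpa [hfr] using hza) hz'
    · intro w hw
      have : p.applySub w = (prAtom ℛ i).applySub w := by
        rw [hp, ← FOAtom.applySub_comp]
        refine FOAtom.applySub_congr fun v hv => ?_
        rw [hprargs] at hv
        have hv : v < N := hNfr v (by simpa [hfr] using hv)
        refine hw.1 (σ v) (FOTerm.var v) ?_
        change (σ v).applySub π = π v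
        rw [hπσ v hv, hπfix v hv]
      simp [hm₁, applySubFS, this]
  have hunif₂ : IsPieceUnifier R₂ (mRi ℛ i).body
      {FOAtom.mapPred hatFn (embedS (ℛ.get i).2)} m₂ := by
    have hhead : FOAtom.mapPred hatFn (embedS (n := ℛ.length) (ℛ.get i).2) =
        H.mapPred RPred.hat := by rw [hi]; rfl
    refine ⟨hne.image _, ?_, ?_, heq, ?_, hadm, ?_, ?_⟩
    · refine (Finset.image_subset_image hsub).trans ?_
      exact Finset.subset_union_left.trans Finset.subset_union_left
    · rw [hhead]
      intro a ha
      obtain ⟨b, hb, rfl⟩ := Finset.mem_image.1 ha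
      rw [Finset.mem_singleton.1 (hsubH hb)]
      exact Finset.mem_singleton_self _
    · simpa only [hm₂, termsFS_image_mapPred] using hcls
    · intro z hz
      obtain ⟨hz, hz'⟩ := Finset.mem_sdiff.1 hz
      rw [mem_varsFS_iff_termsFS, hm₂, termsFS_image_mapPred] at hz
      obtain ⟨a, ha, hza⟩ := mem_termsFS.1 hz
      rw [Finset.mem_singleton.1 (hsubH ha)] at hza
      rw [hbody] at hz'
      exact absurd ((hmem_fr z).2 hza) hz'
    · intro w hw
      simp only [hm₂, applySubFS_image_mapPred]
      rw [hunif w hw]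
  -- the substitution `u'` is associated with the join of both partitions
  have hconst : ∀ s t, joinRel [m₁.rel, m₂.rel] s t → s.applySub u' = t.applySub u' := by
    intro s t hst
    refine eq_of_joinRel ?_ hst
    intro r hr s t hst
    rcases List.mem_cons.1 hr with rfl | hr
    · rw [hu'π, hu'π, show s.applySub π = t.applySub π from hst]
    · rw [List.mem_singleton.1 hr] at hst
      rcases hcls s t hst with rfl | ⟨hs, ht⟩
      · rfl
      have hsmall : ∀ t ∈ termsFS m.Q' ∪ termsFS m.H', t.applySub u' = t.applySub u := by
        intro t ht
        refine FOTerm.applySub_congr fun v hv => hu'fix v ?_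
        subst hv
        rcases Finset.mem_union.1 ht with ht | ht <;> obtain ⟨a, ha, hta⟩ := mem_termsFS.1 ht
        · exact hNQ v (mem_varsFS.2 ⟨a, hsub ha, hta⟩)
        · rw [Finset.mem_singleton.1 (hsubH ha)] at hta
          exact hNfr v ((hmem_fr v).2 hta)
      rw [hsmall s hs, hsmall t ht]
      exact hu.1 s t hst
  have hassoc : IsAssocSub (DisjPieceUnif.rel ⟨[R₁, R₂], [m₁, m₂]⟩) u' := by
    refine isAssocSub_of_const_of_mem hconst fun t => ?_
    have hπidem : (t.applySub π).applySub π = t.applySub π := by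
      obtain v | c := t
      · by_cases hv : N ≤ v ∧ v - N ∈ fr
        · simp only [FOTerm.applySub, hπ, hv, and_self, if_true]
          exact hπfix _ (hNfr _ hv.2)
        · simp only [FOTerm.applySub, hπ, hv, if_false]
      · rfl
    rw [hu'π]
    exact Relation.EqvGen.trans _ _ _
      (joinRel_of_mem (r := m₁.rel) (by simp) hπidem.symm)
      (joinRel_of_mem (r := m₂.rel) (by simp) (hu.2.1 (t.applySub π)))
  have hcopy₁ : IsSafeCopy (QRi ℛ i) R₁ := by
    refine ⟨ρ, hρ, ?_⟩
    change R₁ = applySubFS σ (QRi ℛ i)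
    rw [QRi_eq, applySubFS_union, applySubFS_hatCQ, hi, Finset.image_empty]
    rfl
  have hcopy₂ : IsSafeCopy (hatCQ ℛ.length Q₀ X) R₂ := by
    refine ⟨ρ₀, hρ₀, ?_⟩
    change R₂ = applySubFS (fun v => FOTerm.var (ρ₀ v)) _
    rw [applySubFS_hatCQ, ← hQ₁]
  have hvars₂ : varsFS R₂ = varsFS Q₁ := by
    ext v
    rw [mem_varsFS_iff_termsFS, mem_varsFS_iff_termsFS, hR₂, termsFS_hatCQ,
      Finset.union_eq_left.2 hX₁Q₁]
  have hvars₁ : ∀ v ∈ varsFS R₁, N ≤ v ∨ (v ∈ varsFS B ∧ v ∉ fr) := by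
    have hσv : ∀ w ∈ varsFS B, ∀ v, σ w = FOTerm.var v →
        N ≤ v ∨ (v ∈ varsFS B ∧ v ∉ fr) := by
      intro w hw v hv
      by_cases hwfr : w ∈ fr
      · rw [hσfr w hwfr] at hv
        cases hv
        exact Or.inl (Nat.le_add_left _ _)
      · rw [hσB w (hNB w hw) hwfr] at hv
        cases hv
        exact Or.inr ⟨hw, hwfr⟩
    intro v hv
    rw [mem_varsFS_iff_termsFS, hR₁, termsFS_union, termsFS_hatCQ, Finset.union_empty,
      Finset.mem_union] at hv
    rcases hv with hv | hv
    · rw [termsFS_applySubFS] at hv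
      obtain ⟨w | c, hw, hwv⟩ := Finset.mem_image.1 hv
      · exact hσv w (mem_varsFS_iff_termsFS.2 hw) v hwv
      · cases hwv
    · obtain ⟨a, ha, hva⟩ := mem_termsFS.1 hv
      rw [Finset.mem_singleton.1 ha, hp, FOAtom.applySub, hprargs, List.map_map] at hva
      obtain ⟨w, hw, hwv⟩ := List.mem_map.1 hva
      exact hσv w (hfrB (List.mem_toFinset.2 hw)) v hwv
  have hμ : IsDisjPieceUnifier (↑𝒬 : Set _) (mRi ℛ i) ⟨[R₁, R₂], [m₁, m₂]⟩ := by
    have hvm : ∀ v, v ∈ (mRi ℛ i).vars → v ∈ fr := fun v hv => by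
      rw [mem_vars_mRi, hi] at hv
      exact List.mem_toFinset.2 hv
    refine isDisjPieceUnifier_pair (h.subset ?_) hcopy₁ hQ₀ hcopy₂ ?_ ?_ ?_ hunif₁ hunif₂
      (relAdmissible_of_const hconst)
    · exact Finset.mem_insert_of_mem (Finset.mem_image_of_mem _ (Finset.mem_univ i))
    · refine Finset.disjoint_left.2 fun v hv hv' => ?_
      have hvfr := hvm v hv'
      rcases hvars₁ v hv with hv | hv
      · exact absurd (hNfr v hvfr) (not_lt.2 hv)
      · exact hv.2 hvfr
    · refine Finset.disjoint_left.2 fun v hv hv' => ?_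
      rw [hvars₂] at hv
      exact hQ₁B v hv (hfrB (hvm v hv'))
    · refine Finset.disjoint_left.2 fun v hv hv' => ?_
      rw [hvars₂] at hv'
      rcases hvars₁ v hv with hv | hv
      · exact absurd (hNQ v hv') (not_lt.2 hv)
      · exact hQ₁B v hv' hv.1
  have hβ : betaRw (mRi ℛ i) ⟨[R₁, R₂], [m₁, m₂]⟩ u' =
      hatCQ ℛ.length (applySubFS u B ∪ applySubFS u (Q₁ \ m.Q')) X' := by
    have hp_notMem : p ∉ hatCQ ℛ.length (applySubFS σ B) ∅ := fun hmem =>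
      pred_ne_pr_of_mem_hatCQ hmem i rfl
    have hsdiff₁ : R₁ \ m₁.Q' = hatCQ ℛ.length (applySubFS σ B) ∅ := by
      rw [hR₁, hm₁, Finset.union_sdiff_right, Finset.sdiff_eq_self_of_disjoint
        (Finset.disjoint_singleton_right.2 hp_notMem)]
    have hsdiff₂ := hatCQ_sdiff ℛ.length Q₁ m.Q' X₁
    have hB : applySubFS u' (applySubFS σ B) = applySubFS u B := by
      rw [← applySubFS_comp]
      refine applySubFS_congr fun v hv => ?_
      rw [hu'π, hπσ v (hNB v hv)]
      rfl
    have hD : applySubFS u' (Q₁ \ m.Q') = applySubFS u (Q₁ \ m.Q') := by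
      refine applySubFS_congr fun v hv => hu'fix v (hNQ v ?_)
      obtain ⟨a, ha, hva⟩ := mem_varsFS.1 hv
      exact mem_varsFS.2 ⟨a, (Finset.mem_sdiff.1 ha).1, hva⟩
    have hT : ∀ Y : Finset (FOTerm ℕ C), (∀ v, FOTerm.var v ∈ Y → v < N) →
        Y.image (FOTerm.applySub u') = Y.image (FOTerm.applySub u) := fun Y hY =>
      Finset.image_congr fun t ht =>
        FOTerm.applySub_congr fun v hv => hu'fix v (hY v (hv ▸ ht))
    have hQ₁N : ∀ v, FOTerm.var v ∈ termsFS Q₁ → v < N := fun v hv =>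
      hNQ v (mem_varsFS_iff_termsFS.2 hv)
    have hall : termsFS (applySubFS u B ∪ applySubFS u (Q₁ \ m.Q')) =
        termsFS (applySubFS u B) ∪ (termsFS Q₁).image (FOTerm.applySub u) := by
      refine Finset.Subset.antisymm ?_ (Finset.union_subset ?_ ?_)
      · rw [termsFS_union, termsFS_applySubFS u (Q₁ \ m.Q')]
        refine Finset.union_subset_union_right (Finset.image_subset_image fun t ht => ?_)
        obtain ⟨a, ha, hta⟩ := mem_termsFS.1 ht
        exact mem_termsFS.2 ⟨a, (Finset.mem_sdiff.1 ha).1, hta⟩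
      · rw [termsFS_union]
        exact Finset.subset_union_left
      · exact Finset.image_subset_iff.2 hterms
    simp only [betaRw, List.zipWith, List.foldr, Finset.union_empty]
    rw [mRi_body, hi, hsdiff₁, show R₂ \ m₂.Q' = _ from hsdiff₂]
    simp only [applySubFS_union, applySubFS_unaryAtoms, applySubFS_image_mapPred,
      applySubFS_hatCQ, hB, hD, Finset.image_empty]
    rw [hT _ hQ₁N, hT _ (fun v hv => hQ₁N v (hX₁Q₁ hv)),
      hT _ (fun v hv => hNfr v (by simpa [hfr] using hv)), hatCQ, hatCQ, hall, hX',
      unaryAtoms_union, unaryAtoms_union, Finset.image_union]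
    ext a
    simp only [Finset.mem_union, unaryAtoms, Finset.image_empty, Finset.notMem_empty]
    tauto
  rw [← hβ]
  exact h.step _ _ _ _ _ (Or.inl (Or.inl ⟨i, rfl⟩)) hμ hassoc

/-- Every CQ of a rewriting with the datalog rules has its hatted version, possibly
extended with atoms on `T`, in a single rewriting with the disjunctive mapping. -/
theorem exists_rewriting_hatCQ {ar : P0 → ℕ} {Q : Finset (FOAtom P0 ℕ C)}
    {ℛ : List (Finset (FOAtom P0 ℕ C) × FOAtom P0 ℕ C)}
    (hdl : ∀ r ∈ ℛ, r.2.varsOf ⊆ varsFS r.1 ∧ NoConstAtom r.2)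
    {𝒬 : Finset (Finset (FOAtom P0 ℕ C))}
    (h : IsPieceRewriting (dlRules ℛ) {Q} 𝒬) :
    ∃ 𝒬₂, IsPieceRewriting (Mred ar ℛ) (UCQred Q ℛ) 𝒬₂ ∧
      ∀ Q' ∈ 𝒬, ∃ X, X ⊆ termsFS Q' ∧ hatCQ ℛ.length Q' X ∈ 𝒬₂ := by
  induction h with
  | refl =>
    refine ⟨UCQred Q ℛ, .refl _, fun Q' hQ' => ⟨∅, by simp, ?_⟩⟩
    rw [Finset.mem_singleton.1 hQ', ← hatFS_addT_image_embedS]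
    exact Finset.mem_insert_self _ _
  | step 𝒬' R μ u _ hR hμ hu ih =>
    obtain ⟨𝒬₂, h𝒬₂, hmem⟩ := ih
    obtain ⟨⟨B, H⟩, hr, rfl⟩ := hR
    obtain ⟨hHB, hH⟩ := hdl _ hr
    obtain ⟨i, hi⟩ := List.get_of_mem hr
    obtain ⟨Q₀, hQ₀, Q₁, m, rfl, hcopy, hdisj, hm⟩ := hμ.exists_singleton
    obtain ⟨X, hX, hXmem⟩ := hmem Q₀ hQ₀
    have hu : IsAssocSub m.rel u := by
      have hu : IsAssocSub (joinRel [m.rel]) u := hu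
      rwa [joinRel_singleton hm.2.2.2.1] at hu
    obtain ⟨X', hX', hstep⟩ := h𝒬₂.mRi_step hi hHB hH hXmem hX hcopy hdisj hm hu
    refine ⟨_, hstep, fun Q' hQ' => ?_⟩
    rcases Finset.mem_insert.1 hQ' with rfl | hQ'
    · have hβ : betaRw (dlRule (B, H)) ⟨[Q₁], [m]⟩ u =
          applySubFS u B ∪ applySubFS u (Q₁ \ m.Q') := by
        simp [betaRw, dlRule]
      rw [hβ]
      exact ⟨X', hX', Finset.mem_insert_self _ _⟩
    · obtain ⟨Y, hY, hYmem⟩ := hmem Q' hQ'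
      exact ⟨Y, hY, Finset.mem_insert_of_mem hYmem⟩

/-- Rewriting with datalog rules preserves arities. -/
theorem IsPieceRewriting.length_args {ar : P0 → ℕ} {Q : Finset (FOAtom P0 ℕ C)}
    {ℛ : List (Finset (FOAtom P0 ℕ C) × FOAtom P0 ℕ C)}
    (hQ : ∀ a ∈ Q, a.args.length = ar a.pred)
    (hℛ : ∀ r ∈ ℛ, ∀ a ∈ r.1, a.args.length = ar a.pred)
    {𝒬 : Finset (Finset (FOAtom P0 ℕ C))}
    (h : IsPieceRewriting (dlRules ℛ) {Q} 𝒬) :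
    ∀ Q' ∈ 𝒬, ∀ a ∈ Q', a.args.length = ar a.pred := by
  have hsub : ∀ (u : FOSubst ℕ C) (S : Finset (FOAtom P0 ℕ C)),
      (∀ a ∈ S, a.args.length = ar a.pred) →
      ∀ a ∈ applySubFS u S, a.args.length = ar a.pred := by
    intro u S hS a ha
    obtain ⟨b, hb, rfl⟩ := Finset.mem_image.1 ha
    simpa [FOAtom.applySub] using hS b hb
  induction h with
  | refl =>
    intro Q' hQ'
    rwa [Finset.mem_singleton.1 hQ']
  | step 𝒬' R μ u _ hR hμ _ ih =>
    obtain ⟨⟨B, H⟩, hr, rfl⟩ := hR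
    obtain ⟨Q₀, hQ₀, Q₁, m, rfl, ⟨ρ, -, rfl⟩, -, -⟩ := hμ.exists_singleton
    intro Q' hQ'
    rcases Finset.mem_insert.1 hQ' with rfl | hQ'
    · intro a ha
      simp only [betaRw, dlRule, List.zipWith, List.foldr, Finset.union_empty,
        Finset.mem_union] at ha
      rcases ha with ha | ha
      · exact hsub u B (hℛ _ hr) a ha
      · exact hsub u _ (fun b hb => hsub _ Q₀ (ih Q₀ hQ₀) b (Finset.mem_sdiff.1 hb).1)
          a ha
    · exact ih Q' hQ'

theorem image_unhatFn_hatCQ (n : ℕ) {Q : Finset (FOAtom P0 ℕ C)} {X : Finset (FOTerm ℕ C)}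
    (hX : X ⊆ termsFS Q) :
    (hatCQ n Q X).image (FOAtom.mapPred unhatFn) = addT (Q.image embedS) := by
  have h : addT (n := n) (Q.image embedS) = Q.image (FOAtom.mapPred RPred.base) ∪
      unaryAtoms RPred.T (termsFS Q) ∪ unaryAtoms RPred.T X := by
    rw [addT_image_embedS, Finset.union_assoc, ← unaryAtoms_union,
      Finset.union_eq_left.2 hX]
  rw [h, hatCQ, Finset.image_union, Finset.image_union]
  simp only [unaryAtoms, Finset.image_image]
  rfl

end Reduction

/-- for every CQ `Q_w` belonging to a piece-rewriting of `{Q}` with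
`ℛ`, the CQ `(Q_w)^T` is isomorphic to a CQ belonging to some piece-rewriting of
`𝒬^{Q,ℛ}` with `ℳ^{Q,ℛ}`. -/
theorem stmt17 {P0 C : Type} [DecidableEq P0] [DecidableEq C]
    (ar : P0 → ℕ) (Q : Finset (FOAtom P0 ℕ C))
    (ℛ : List (Finset (FOAtom P0 ℕ C) × FOAtom P0 ℕ C))
    -- ℛ is a set of constant-free datalog rules
    (hdl : ∀ r ∈ ℛ, r.1.Nonempty ∧ r.2.varsOf ⊆ varsFS r.1 ∧
        NoConstFS r.1 ∧ NoConstAtom r.2)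
    -- atoms respect the arities of the vocabulary
    (hQar : ∀ a ∈ Q, a.args.length = ar a.pred)
    (hRar : ∀ r ∈ ℛ, (∀ a ∈ r.1, a.args.length = ar a.pred) ∧
        r.2.args.length = ar r.2.pred)
    (Qw : Finset (FOAtom P0 ℕ C))
    -- Q_w belongs to a piece-rewriting of {Q} with ℛ
    (hQw : ∃ 𝒬w : Finset (Finset (FOAtom P0 ℕ C)),
        IsPieceRewriting (dlRules ℛ) {Q} 𝒬w ∧ Qw ∈ 𝒬w) :
    -- (Q_w)^T is isomorphic to a CQ of a piece-rewriting of 𝒬^{Q,ℛ} with ℳ^{Q,ℛ}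
    ∃ 𝒬₂ : Finset (Finset (FOAtom (RPred P0 ℛ.length) ℕ C)),
      IsPieceRewriting (Mred ar ℛ) (UCQred Q ℛ) 𝒬₂ ∧
      ∃ Q₂ ∈ 𝒬₂, IsoCQ (addT (Qw.image embedS)) Q₂ := by
  obtain ⟨𝒬w, h𝒬w, hmem⟩ := hQw
  obtain ⟨𝒬₂, h𝒬₂, hhat⟩ := exists_rewriting_hatCQ (ar := ar)
    (fun r hr => ⟨(hdl r hr).2.1, (hdl r hr).2.2.2⟩) h𝒬w
  obtain ⟨X, hX, hXmem⟩ := hhat Qw hmem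
  have har := h𝒬w.length_args hQar (fun r hr => (hRar r hr).1) Qw hmem
  rw [← image_unhatFn_hatCQ _ hX]
  refine h𝒬₂.exists_mapPred unhatFn_unhatFn _ _ hXmem ?_ le_rfl
  intro a ha hne
  simp only [hatCQ, Finset.mem_union, Finset.mem_image, mem_unaryAtoms] at ha
  rcases ha with (⟨b, hb, rfl⟩ | ⟨t, -, rfl⟩) | ⟨t, -, rfl⟩
  · refine Or.inl (Or.inr ⟨b.pred, ?_⟩)
    rw [transRule, ← har b hb]
    rfl
  · exact Or.inr rfl
  · exact absurd rfl hne
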